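/- Let N_t > 2 be an integer and let λ₁ > λ₂ > 0 be real numbers. Let v = (v₁, …, v_{N_t}) be a random vector uniformly distributed on the unit sphere {v ∈ ℂ^{N_t} : ‖v‖ = 1} (i.e., distributed according to the normalized rotation-invariant surface measure). Then for every x with λ₂ ≤ x ≤ λ₁, the probability P(λ₁|v₁|² + λ₂|v₂|² ≤ x) equals 1 − (λ₁ − x)^{N_t−1} / ((λ₁ − λ₂)·λ₁^{N_t−2}). -/

import Mathlib

open MeasureTheory

section
open RealInnerProductSpace

theorem aux_unique {E : Type*} [NormedAddCommGroup E] [InnerProductSpace ℝ E]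
    [FiniteDimensional ℝ E] [MeasurableSpace E] [BorelSpace E]
    (μ ν : Measure E) [IsProbabilityMeasure μ] [IsProbabilityMeasure ν]
    (hμ : ∀ᵐ v ∂μ, ‖v‖ = 1) (hν : ∀ᵐ v ∂ν, ‖v‖ = 1)
    (h1 : ∀ s t : E, ‖s‖ = ‖t‖ → charFun μ s = charFun μ t)
    (h2 : ∀ s t : E, ‖s‖ = ‖t‖ → charFun ν s = charFun ν t) : μ = ν := by
  apply Measure.ext_of_charFun
  ext t
  have e1 : charFun μ t = ∫ w, charFun μ (‖t‖ • w) ∂ν := by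
    have : ∫ w, charFun μ (‖t‖ • w) ∂ν = ∫ w, charFun μ t ∂ν := by
      apply integral_congr_ae
      filter_upwards [hν] with w hw
      apply h1
      simp [norm_smul, hw]
    simp [this]
  have e2 : charFun ν t = ∫ w, charFun ν (‖t‖ • w) ∂μ := by
    have : ∫ w, charFun ν (‖t‖ • w) ∂μ = ∫ w, charFun ν t ∂μ := by
      apply integral_congr_ae
      filter_upwards [hμ] with w hw
      apply h2
      simp [norm_smul, hw]
    simp [this]
  rw [e1, e2]
  simp only [charFun_apply]
  rw [integral_integral_swap]
  · congr 1
    ext x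
    congr 1
    ext y
    rw [inner_smul_right, inner_smul_right, real_inner_comm]
  · apply Integrable.of_bound (C := 1)
    · apply Continuous.aestronglyMeasurable
      simp only [Function.uncurry_def]
      fun_prop
    · filter_upwards with p
      simp only [Function.uncurry_def]
      rw [Complex.norm_exp_ofReal_mul_I]

end

theorem aux_trans {n : ℕ} (a b : EuclideanSpace ℂ (Fin n)) (h : ‖a‖ = ‖b‖) :
    ∃ U : EuclideanSpace ℂ (Fin n) ≃ₗᵢ[ℂ] EuclideanSpace ℂ (Fin n), U a = b := by
  by_cases ha : a = 0
  · subst ha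
    have : b = 0 := by simpa using h.symm
    exact ⟨LinearIsometryEquiv.refl _ _, by simp [this]⟩
  have hna : ‖a‖ ≠ 0 := by simpa using ha
  let c : ℂ := (‖a‖ : ℂ)⁻¹
  have ha1 : ‖c • a‖ = 1 := by simp [c, norm_smul, hna]
  have hb1 : ‖c • b‖ = 1 := by simp [c, norm_smul, h, h ▸ hna]
  let L := ((Submodule.span ℂ {c • b}).subtypeₗᵢ.comp
    (LinearIsometryEquiv.toSpanUnitSingleton (𝕜 := ℂ) (c • b) hb1).toLinearIsometry).comp
    (LinearIsometryEquiv.toSpanUnitSingleton (𝕜 := ℂ) (c • a) ha1).symm.toLinearIsometry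
  refine ⟨L.extend.toLinearIsometryEquiv rfl, ?_⟩
  have hc : c ≠ 0 := by simp [c, ha]
  have key : L.extend (c • a) = c • b := by
    have := L.extend_apply (LinearIsometryEquiv.toSpanUnitSingleton (𝕜 := ℂ) (c • a) ha1 1)
    have h1 : ((LinearIsometryEquiv.toSpanUnitSingleton (𝕜 := ℂ) (c • a) ha1 1 :
        Submodule.span ℂ {c • a}) : EuclideanSpace ℂ (Fin n)) = c • a := by simp
    rw [h1] at this
    rw [this]
    change ((LinearIsometryEquiv.toSpanUnitSingleton (𝕜 := ℂ) (c • b) hb1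
      ((LinearIsometryEquiv.toSpanUnitSingleton (𝕜 := ℂ) (c • a) ha1).symm
        (LinearIsometryEquiv.toSpanUnitSingleton (𝕜 := ℂ) (c • a) ha1 1)) :
        Submodule.span ℂ {c • b}) : EuclideanSpace ℂ (Fin n)) = c • b
    rw [LinearIsometryEquiv.symm_apply_apply]
    simp
  rw [map_smul] at key
  simpa using smul_right_injective _ hc key

theorem aux_inner {n : ℕ} (U : EuclideanSpace ℂ (Fin n) ≃ₗᵢ[ℂ] EuclideanSpace ℂ (Fin n))
    (x y : EuclideanSpace ℂ (Fin n)) : inner ℝ (U x) (U y) = inner ℝ x y := by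
  have h : ∀ x y : EuclideanSpace ℂ (Fin n), inner ℝ x y = (inner ℂ x y).re := by
    intro x y
    rw [PiLp.inner_apply, PiLp.inner_apply, Complex.re_sum]
    rfl
  rw [h, h, U.inner_map_map]

theorem aux_charFun_inv {n : ℕ} (μ : Measure (EuclideanSpace ℂ (Fin n)))
    (hinv : ∀ U : EuclideanSpace ℂ (Fin n) ≃ₗᵢ[ℂ] EuclideanSpace ℂ (Fin n),
      Measure.map (⇑U) μ = μ) (s t : EuclideanSpace ℂ (Fin n)) (h : ‖s‖ = ‖t‖) :
    charFun μ s = charFun μ t := by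
  obtain ⟨U, rfl⟩ := aux_trans s t h
  conv_rhs => rw [← hinv U]
  simp only [charFun_apply]
  rw [integral_map (U.continuous.aemeasurable) (Continuous.aestronglyMeasurable (by fun_prop))]
  simp only [aux_inner]

/-- converse -/
theorem aux_inv_of_charFun {n : ℕ} (μ : Measure (EuclideanSpace ℂ (Fin n))) [IsFiniteMeasure μ]
    (h : ∀ s t, ‖s‖ = ‖t‖ → charFun μ s = charFun μ t)
    (U : EuclideanSpace ℂ (Fin n) ≃ₗᵢ[ℂ] EuclideanSpace ℂ (Fin n)) :
    Measure.map (⇑U) μ = μ := by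
  apply Measure.ext_of_charFun
  ext t
  obtain ⟨t, rfl⟩ := U.surjective t
  rw [← h t (U t) (U.norm_map t).symm]
  simp only [charFun_apply]
  rw [integral_map (U.continuous.aemeasurable) (Continuous.aestronglyMeasurable (by fun_prop))]
  simp only [aux_inner]

noncomputable def gdens (z : ℂ) : ENNReal :=
  ENNReal.ofReal ((2 * Real.pi)⁻¹ * Real.exp (-(1/2) * ‖z‖ ^ 2))

noncomputable def gam1 : Measure ℂ := volume.withDensity gdens

theorem measurable_gdens : Measurable gdens := by
  unfold gdens; fun_prop

theorem gam1_exp (c : ℝ) (hc : 0 ≤ c) :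
    ∫⁻ z, ENNReal.ofReal (Real.exp (-(c/2) * ‖z‖ ^ 2)) ∂gam1 = ENNReal.ofReal (1 / (1 + c)) := by
  rw [gam1, lintegral_withDensity_eq_lintegral_mul _ measurable_gdens (by fun_prop)]
  have hb : 0 < (1 + c) / 2 := by positivity
  have hint := GaussianFourier.integral_rexp_neg_mul_sq_norm (V := ℂ) hb
  have hfun : ∀ z : ℂ, (gdens * fun z : ℂ => ENNReal.ofReal (Real.exp (-(c/2) * ‖z‖ ^ 2))) z
      = ENNReal.ofReal ((2 * Real.pi)⁻¹ * Real.exp (-((1 + c) / 2) * ‖z‖ ^ 2)) := by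
    intro z
    simp only [Pi.mul_apply, gdens]
    rw [← ENNReal.ofReal_mul (by positivity), mul_assoc, ← Real.exp_add]
    ring_nf
  simp_rw [hfun]
  have hI : Integrable (fun v : ℂ => Real.exp (-((1 + c) / 2) * ‖v‖ ^ 2)) := by
    by_contra hcon
    rw [integral_undef hcon] at hint
    have : 0 < (Real.pi / ((1 + c) / 2)) ^ ((Module.finrank ℝ ℂ : ℝ) / 2) := by positivity
    linarith
  rw [← ofReal_integral_eq_lintegral_ofReal (hI.const_mul _) (by filter_upwards with z; positivity),
    integral_const_mul, hint]
  congr 1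
  simp
  field_simp

instance : IsProbabilityMeasure gam1 := by
  constructor
  have := gam1_exp 0 le_rfl
  simpa using this

instance : NullSingletonClass gam1 := by
  unfold gam1; infer_instance

theorem gam1_charFun (t : ℂ) : charFun gam1 t = Complex.exp (-(‖t‖ : ℂ) ^ 2 / 2) := by
  rw [charFun_apply, gam1]
  have hm : Measurable fun z : ℂ => ((2 * Real.pi)⁻¹ * Real.exp (-(1/2) * ‖z‖ ^ 2)) := by fun_prop
  unfold gdens
  rw [integral_withDensity_eq_integral_toReal_smul (by fun_prop) (by simp)]
  have h := GaussianFourier.integral_cexp_neg_mul_sq_norm_add (V := ℂ) (b := 1/2) (by norm_num)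
    Complex.I t
  have hfun : ∀ z : ℂ, (ENNReal.ofReal ((2 * Real.pi)⁻¹ * Real.exp (-(1/2) * ‖z‖ ^ 2))).toReal •
      Complex.exp ((inner ℝ z t : ℝ) * Complex.I) = (2 * Real.pi : ℂ)⁻¹ *
        Complex.exp (-(1/2) * (‖z‖ : ℂ) ^ 2 + Complex.I * (inner ℝ t z : ℝ)) := by
    intro z
    rw [ENNReal.toReal_ofReal (by positivity), Complex.exp_add, real_inner_comm, Complex.real_smul]
    push_cast
    ring_nf
  simp_rw [hfun]
  rw [integral_const_mul, h]
  have : (Real.pi : ℂ) ≠ 0 := by simp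
  simp
  field_simp
  congr 1
  ring

theorem gam1_tail (q : ℝ) (hq : 0 ≤ q) :
    gam1 {z | q < ‖z‖ ^ 2} = ENNReal.ofReal (Real.exp (-(1/2) * q)) := by
  have hms : MeasurableSet {z : ℂ | q < ‖z‖ ^ 2} := measurableSet_lt (by fun_prop) (by fun_prop)
  rw [gam1, withDensity_apply _ hms, ← lintegral_indicator hms,
    ← Complex.lintegral_comp_polarCoord_symm, polarCoord_target]
  have hfun : ∀ p ∈ Set.Ioi (0:ℝ) ×ˢ Set.Ioo (-Real.pi) Real.pi,
      ENNReal.ofReal p.1 • {z : ℂ | q < ‖z‖ ^ 2}.indicator gdens (Complex.polarCoord.symm p)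
      = (Set.Ioi (√q)).indicator (fun r => ENNReal.ofReal ((2 * Real.pi)⁻¹ * (r * Real.exp (-(1/2) * r ^ 2)))) p.1 * 1 := by
    rintro ⟨r, θ⟩ ⟨hr, hθ⟩
    simp only [Set.mem_Ioi] at hr
    have hn : ‖Complex.polarCoord.symm (r, θ)‖ = r := by
      rw [Complex.norm_polarCoord_symm]; exact abs_of_pos hr
    simp only [Set.indicator_apply, Set.mem_ofPred_eq, hn, Set.mem_Ioi, Real.sqrt_lt' hr, gdens]
    split_ifs
    · rw [smul_eq_mul, ← ENNReal.ofReal_mul hr.le, mul_one]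
      ring_nf
    · simp
  rw [setLIntegral_congr_fun (measurableSet_Ioi.prod measurableSet_Ioo) hfun,
    Measure.volume_eq_prod, ← Measure.prod_restrict]
  have hmeas : Measurable ((Set.Ioi (√q)).indicator (fun r : ℝ => ENNReal.ofReal ((2 * Real.pi)⁻¹ * (r * Real.exp (-(1/2) * r ^ 2))))) :=
    Measurable.indicator (by fun_prop) measurableSet_Ioi
  rw [lintegral_prod_mul (f := (Set.Ioi (√q)).indicator (fun r => ENNReal.ofReal ((2 * Real.pi)⁻¹ * (r * Real.exp (-(1/2) * r ^ 2))))) (g := fun _ => 1) hmeas.aemeasurable (by fun_prop)]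
  rw [lintegral_indicator measurableSet_Ioi, Measure.restrict_restrict measurableSet_Ioi,
    Set.inter_eq_left.2 (Set.Ioi_subset_Ioi (Real.sqrt_nonneg q))]
  have hderiv : ∀ r ∈ Set.Ici (√q), HasDerivAt (fun r : ℝ => -((2 * Real.pi)⁻¹ * Real.exp (-(1/2) * r ^ 2)))
      ((2 * Real.pi)⁻¹ * (r * Real.exp (-(1/2) * r ^ 2))) r := by
    intro r _
    have := ((((hasDerivAt_pow 2 r).const_mul (-(1/2))).exp).const_mul ((2 * Real.pi)⁻¹)).neg
    convert! this using 1
    simp; ring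
  have hpos : ∀ r ∈ Set.Ioi (√q), 0 ≤ (2 * Real.pi)⁻¹ * (r * Real.exp (-(1/2) * r ^ 2)) := by
    intro r hr
    have : 0 ≤ r := (Real.sqrt_nonneg q).trans (le_of_lt hr)
    positivity
  have hlim : Filter.Tendsto (fun r : ℝ => -((2 * Real.pi)⁻¹ * Real.exp (-(1/2) * r ^ 2))) Filter.atTop (nhds 0) := by
    have h1 : Filter.Tendsto (fun r : ℝ => -(1/2) * r ^ 2) Filter.atTop Filter.atBot :=
      (Filter.tendsto_pow_atTop two_ne_zero).const_mul_atTop_of_neg (by norm_num)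
    simpa using ((Real.tendsto_exp_atBot.comp h1).const_mul ((2 * Real.pi)⁻¹)).neg
  have hI := integrableOn_Ioi_deriv_of_nonneg' hderiv hpos hlim
  have hv := integral_Ioi_of_hasDerivAt_of_nonneg' hderiv hpos hlim
  rw [← ofReal_integral_eq_lintegral_ofReal hI ((ae_restrict_iff' measurableSet_Ioi).2 (Filter.Eventually.of_forall hpos)), hv]
  simp only [lintegral_one, Measure.restrict_apply_univ, Real.volume_Ioo]
  rw [← ENNReal.ofReal_mul (by simp; positivity), Real.sq_sqrt hq]
  congr 1
  field_simp
  ring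

theorem lintegral_pi_prod' {n : ℕ} (c : Fin n → ℝ) (hc : ∀ i, 0 ≤ c i) :
    ∫⁻ y : Fin n → ℂ, ∏ i, ENNReal.ofReal (Real.exp (-(c i / 2) * ‖y i‖ ^ 2))
      ∂(Measure.pi fun _ => gam1) = ∏ i, ENNReal.ofReal (1 / (1 + c i)) := by
  have hind := ProbabilityTheory.iIndepFun_pi (μ := fun _ : Fin n => gam1)
    (X := fun i (z : ℂ) => ENNReal.ofReal (Real.exp (-(c i / 2) * ‖z‖ ^ 2)))
    (fun i => by fun_prop)
  rw [ProbabilityTheory.lintegral_prod_eq_prod_lintegral_of_indepFun _ _ hind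
    (fun i => by fun_prop)]
  apply Finset.prod_congr rfl
  intro i _
  rw [← gam1_exp (c i) (hc i)]
  exact (measurePreserving_eval (fun _ : Fin n => gam1) i).lintegral_comp
    (f := fun z : ℂ => ENNReal.ofReal (Real.exp (-(c i / 2) * ‖z‖ ^ 2))) (by fun_prop)

theorem pi_prob (k : ℕ) (lam1 lam2 x : ℝ) (h21 : lam2 < lam1) (h2 : 0 < lam2)
    (hx0 : lam2 ≤ x) (hx : x < lam1) :
    Measure.pi (fun _ : Fin (k + 2) => gam1)
      {z | x * ∑ i, ‖z i‖ ^ 2 < lam1 * ‖z 0‖ ^ 2 + lam2 * ‖z 1‖ ^ 2} =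
    ENNReal.ofReal ((lam1 - x) ^ (k + 1) / ((lam1 - lam2) * lam1 ^ k)) := by
  have hd : 0 < lam1 - x := by linarith
  have hxpos : 0 < x := by linarith
  let s : ℝ := (x - lam2) / (lam1 - x)
  let t : ℝ := x / (lam1 - x)
  have hs : 0 ≤ s := div_nonneg (by linarith) hd.le
  have ht : 0 ≤ t := div_nonneg (by linarith) hd.le
  let c : Fin (k + 1) → ℝ := Fin.cons s (fun _ => t)
  have hc : ∀ i, 0 ≤ c i := by
    intro i
    refine Fin.cases ?_ (fun j => ?_) i
    · simpa [c] using hs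
    · simpa [c] using ht
  have hmp := measurePreserving_piFinSuccAbove (fun _ : Fin (k + 2) => gam1) 0
  let S : Set (ℂ × (Fin (k + 1) → ℂ)) := {p | ∑ i, c i * ‖p.2 i‖ ^ 2 < ‖p.1‖ ^ 2}
  have hS : MeasurableSet S := measurableSet_lt (by fun_prop) (by fun_prop)
  have hset : {z : Fin (k + 2) → ℂ | x * ∑ i, ‖z i‖ ^ 2 < lam1 * ‖z 0‖ ^ 2 + lam2 * ‖z 1‖ ^ 2}
      = (MeasurableEquiv.piFinSuccAbove (fun _ => ℂ) 0) ⁻¹' S := by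
    ext z
    have e : ∑ i, c i * ‖z (Fin.succ i)‖ ^ 2 =
        (x * ∑ i, ‖z i‖ ^ 2 - x * ‖z 0‖ ^ 2 - lam2 * ‖z 1‖ ^ 2) / (lam1 - x) := by
      rw [Fin.sum_univ_succ, Fin.sum_univ_succ (n := k + 1), Fin.sum_univ_succ (n := k)]
      simp only [c, Fin.cons_zero, Fin.cons_succ, Fin.succ_zero_eq_one, ← Finset.mul_sum, s, t]
      field_simp
      ring
    have e2 : z ∈ (MeasurableEquiv.piFinSuccAbove (fun _ => ℂ) 0) ⁻¹' S ↔
      ∑ i, c i * ‖z (Fin.succ i)‖ ^ 2 < ‖z 0‖ ^ 2 := Iff.rfl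
    rw [e2, e, div_lt_iff₀ hd]
    rw [Set.mem_ofPred_eq]
    constructor <;> intro h <;> nlinarith
  rw [hset, hmp.measure_preimage hS.nullMeasurableSet, Measure.prod_apply_symm hS]
  have hsec : ∀ y : Fin (k + 1) → ℂ, gam1 ((fun z => (z, y)) ⁻¹' S) =
      ∏ i, ENNReal.ofReal (Real.exp (-(c i / 2) * ‖y i‖ ^ 2)) := by
    intro y
    have := gam1_tail (∑ i, c i * ‖y i‖ ^ 2)
      (Finset.sum_nonneg fun i _ => mul_nonneg (hc i) (by positivity))
    refine this.trans ?_
    rw [← ENNReal.ofReal_prod_of_nonneg (fun i _ => (Real.exp_pos _).le), ← Real.exp_sum,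
      Finset.mul_sum]
    congr 2
    apply Finset.sum_congr rfl
    intro i _
    ring
  simp_rw [hsec]
  rw [lintegral_pi_prod' c hc, ← ENNReal.ofReal_prod_of_nonneg
    (fun i _ => by have := hc i; positivity), Fin.prod_univ_succ]
  congr 1
  have h1 : 0 < lam1 := by linarith
  have h3 : 0 < lam1 - lam2 := by linarith
  have es : 1 / (1 + s) = (lam1 - x) / (lam1 - lam2) := by
    have : 1 + s = (lam1 - lam2) / (lam1 - x) := by simp only [s]; field_simp; ring
    rw [this, one_div_div]
  have et : 1 / (1 + t) = (lam1 - x) / lam1 := by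
    have : 1 + t = lam1 / (lam1 - x) := by simp only [t]; field_simp; ring
    rw [this, one_div_div]
  simp only [c, Fin.cons_zero, Fin.cons_succ, es, et, Finset.prod_const, Finset.card_univ,
    Fintype.card_fin]
  rw [div_pow, div_mul_div_comm, ← pow_succ']

noncomputable def gam (n : ℕ) : Measure (EuclideanSpace ℂ (Fin n)) :=
  (Measure.pi fun _ : Fin n => gam1).map (WithLp.toLp 2)

instance (n : ℕ) : IsProbabilityMeasure (gam n) :=
  Measure.isProbabilityMeasure_map (by fun_prop)

theorem gam_charFun (n : ℕ) (t : EuclideanSpace ℂ (Fin n)) :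
    charFun (gam n) t = Complex.exp (-(‖t‖ : ℂ) ^ 2 / 2) := by
  rw [gam, charFun_pi]
  simp_rw [gam1_charFun]
  rw [← Complex.exp_sum, ← Complex.ofReal_pow, EuclideanSpace.norm_sq_eq]
  simp [Finset.sum_div, neg_div]

theorem main_aux (k : ℕ) (lam1 lam2 : ℝ) (h21 : lam2 < lam1) (h2 : 0 < lam2)
    (μ : Measure (EuclideanSpace ℂ (Fin (k + 2)))) [IsProbabilityMeasure μ]
    (hsphere : ∀ᵐ v ∂μ, ‖v‖ = 1)
    (hinv : ∀ U : EuclideanSpace ℂ (Fin (k + 2)) ≃ₗᵢ[ℂ] EuclideanSpace ℂ (Fin (k + 2)),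
      Measure.map (⇑U) μ = μ)
    (x : ℝ) (hx0 : lam2 ≤ x) (hx : x < lam1) :
    μ {v | lam1 * ‖v 0‖ ^ 2 + lam2 * ‖v 1‖ ^ 2 ≤ x}ᶜ
      = ENNReal.ofReal ((lam1 - x) ^ (k + 1) / ((lam1 - lam2) * lam1 ^ k)) := by
  let N : EuclideanSpace ℂ (Fin (k + 2)) → EuclideanSpace ℂ (Fin (k + 2)) :=
    fun v => ((‖v‖ : ℂ)⁻¹) • v
  have hN : Measurable N := by fun_prop
  let ν := (gam (k + 2)).map N
  have : IsProbabilityMeasure ν := Measure.isProbabilityMeasure_map hN.aemeasurable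
  have hne : ∀ᵐ v ∂(gam (k + 2)), v ≠ 0 := by
    rw [gam, ae_map_iff (by fun_prop)
      (p := fun v => v ≠ 0) (measurableSet_singleton (0 : EuclideanSpace ℂ (Fin (k + 2)))).compl]
    have h0 : (Measure.pi fun _ : Fin (k + 2) => gam1) {0} = 0 := measure_singleton _
    filter_upwards [compl_mem_ae_iff.2 h0] with z hz
    simpa using hz
  have hνs : ∀ᵐ v ∂ν, ‖v‖ = 1 := by
    rw [ae_map_iff hN.aemeasurable (measurableSet_eq_fun (by fun_prop) (by fun_prop))]
    filter_upwards [hne] with v hv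
    simp [N, norm_smul, hv]
  have hνi : ∀ U : EuclideanSpace ℂ (Fin (k + 2)) ≃ₗᵢ[ℂ] EuclideanSpace ℂ (Fin (k + 2)),
      Measure.map (⇑U) ν = ν := by
    intro U
    have hU : Measurable U := U.continuous.measurable
    have hg := aux_inv_of_charFun (gam (k + 2))
      (fun s t h => by rw [gam_charFun, gam_charFun, h]) U
    have hcomm : U ∘ N = N ∘ U := by
      ext1 v
      simp [N]
    simp only [ν]
    rw [Measure.map_map hU hN, hcomm, ← Measure.map_map hN hU, hg]
  have hμν : μ = ν := aux_unique μ ν hsphere hνs (aux_charFun_inv μ hinv) (aux_charFun_inv ν hνi)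
  have hA : MeasurableSet {v : EuclideanSpace ℂ (Fin (k + 2)) |
      lam1 * ‖v 0‖ ^ 2 + lam2 * ‖v 1‖ ^ 2 ≤ x} :=
    measurableSet_le (by fun_prop) (by fun_prop)
  rw [hμν, ← pi_prob k lam1 lam2 x h21 h2 hx0 hx]
  simp only [ν]
  rw [Measure.map_apply hN hA.compl, gam, Measure.map_apply (by fun_prop) (hN hA.compl)]
  congr 1
  ext z
  have hsum : ∑ i, ‖z i‖ ^ 2 = ‖(WithLp.toLp 2 z : EuclideanSpace ℂ (Fin (k + 2)))‖ ^ 2 := by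
    rw [EuclideanSpace.norm_sq_eq]
  change ¬ (lam1 * ‖N (WithLp.toLp 2 z) 0‖ ^ 2 + lam2 * ‖N (WithLp.toLp 2 z) 1‖ ^ 2 ≤ x) ↔
    x * ∑ i, ‖z i‖ ^ 2 < lam1 * ‖z 0‖ ^ 2 + lam2 * ‖z 1‖ ^ 2
  rw [hsum]
  have hNi : ∀ i, ‖N (WithLp.toLp 2 z) i‖ =
      ‖z i‖ / ‖(WithLp.toLp 2 z : EuclideanSpace ℂ (Fin (k + 2)))‖ := by
    intro i
    simp [N, div_eq_inv_mul]
  rw [hNi, hNi, not_le]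
  by_cases hz : z = 0
  · subst hz
    simp
    linarith
  · have hp : 0 < ‖(WithLp.toLp 2 z : EuclideanSpace ℂ (Fin (k + 2)))‖ := by simpa using hz
    rw [div_pow, div_pow, mul_div_assoc', mul_div_assoc', ← add_div, lt_div_iff₀ (by positivity)]

/-- For `v` uniformly distributed on the unit sphere of `ℂ^{N_t}` (the unique
rotation-invariant probability measure), `N_t > 2`, `λ₁ > λ₂ > 0`, and `λ₂ ≤ x ≤ λ₁`,
the cdf of `λ₁|v₁|² + λ₂|v₂|²` at `x` equals
`1 − (λ₁ − x)^{N_t−1} / ((λ₁ − λ₂) λ₁^{N_t−2})`. -/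
theorem stmt1 (Nt : ℕ) (hNt : 2 < Nt) (lam1 lam2 : ℝ) (h21 : lam2 < lam1) (h2 : 0 < lam2)
    [MeasurableSpace (EuclideanSpace ℂ (Fin Nt))] [BorelSpace (EuclideanSpace ℂ (Fin Nt))]
    (μ : Measure (EuclideanSpace ℂ (Fin Nt))) [IsProbabilityMeasure μ]
    (hsphere : ∀ᵐ v ∂μ, ‖v‖ = 1)
    (hinv : ∀ U : EuclideanSpace ℂ (Fin Nt) ≃ₗᵢ[ℂ] EuclideanSpace ℂ (Fin Nt),
      Measure.map (⇑U) μ = μ)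
    (x : ℝ) (hx0 : lam2 ≤ x) (hx : x ≤ lam1) :
    (μ {v | lam1 * ‖v ⟨0, by omega⟩‖ ^ 2 + lam2 * ‖v ⟨1, by omega⟩‖ ^ 2 ≤ x}).toReal
      = 1 - (lam1 - x) ^ (Nt - 1) / ((lam1 - lam2) * lam1 ^ (Nt - 2)) := by
  have hinst : ‹MeasurableSpace (EuclideanSpace ℂ (Fin Nt))› = WithLp.measurableSpace 2 (Fin Nt → ℂ) := by
    rw [‹BorelSpace (EuclideanSpace ℂ (Fin Nt))›.measurable_eq]
    exact BorelSpace.measurable_eq.symm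
  subst hinst
  obtain ⟨k, rfl⟩ : ∃ k, Nt = k + 2 := ⟨Nt - 2, by omega⟩
  have hA : MeasurableSet {v : EuclideanSpace ℂ (Fin (k + 2)) |
      lam1 * ‖v 0‖ ^ 2 + lam2 * ‖v 1‖ ^ 2 ≤ x} :=
    measurableSet_le (by fun_prop) (by fun_prop)
  change μ.real {v : EuclideanSpace ℂ (Fin (k + 2)) |
      lam1 * ‖v 0‖ ^ 2 + lam2 * ‖v 1‖ ^ 2 ≤ x} =
    1 - (lam1 - x) ^ (k + 1) / ((lam1 - lam2) * lam1 ^ k)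
  have hpos : 0 ≤ (lam1 - x) ^ (k + 1) / ((lam1 - lam2) * lam1 ^ k) := by
    have h1 : 0 < lam1 := by linarith
    have h3 : 0 < lam1 - lam2 := by linarith
    have h4 : 0 ≤ lam1 - x := by linarith
    positivity
  have hcompl := probReal_compl_eq_one_sub (μ := μ) hA
  rcases hx.lt_or_eq with hlt | rfl
  · have := main_aux k lam1 lam2 h21 h2 μ hsphere hinv x hx0 hlt
    rw [measureReal_def, this, ENNReal.toReal_ofReal hpos] at hcompl
    linarith
  · have hfull : μ {v : EuclideanSpace ℂ (Fin (k + 2)) |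
        x * ‖v 0‖ ^ 2 + lam2 * ‖v 1‖ ^ 2 ≤ x}ᶜ = 0 := by
      change ∀ᵐ v ∂μ, x * ‖v 0‖ ^ 2 + lam2 * ‖v 1‖ ^ 2 ≤ x
      filter_upwards [hsphere] with v hv
      have hs := EuclideanSpace.norm_sq_eq v
      rw [hv, Fin.sum_univ_succ, Fin.sum_univ_succ, Fin.succ_zero_eq_one] at hs
      have hr : 0 ≤ ∑ i : Fin k, ‖v i.succ.succ‖ ^ 2 := Finset.sum_nonneg fun i _ => by positivity
      nlinarith [sq_nonneg ‖v 1‖, sq_nonneg ‖v 0‖]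
    rw [measureReal_def, hfull] at hcompl
    simp at hcompl ⊢
    linarith
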